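/- Let Ω be a Polish metric space, ν₀ a compactly supported Borel probability measure on Ω, 𝔞 : Ω → 𝕋^d continuous, X = Ω^ℤ, and f(ω, θ) = (σω, θ + 𝔞(ω₀)) on X × 𝕋^d. Assume f is ergodic with respect to ν₀^ℤ × m. Let φ : X × 𝕋^d → ℝ be a bounded continuous observable that depends only on finitely many coordinates of ω ∈ X (and on θ). Then for every ε > 0 there exist δ > 0, n̄ ∈ ℕ and c > 0 (all depending only on ε, ν₀, φ) such that for every compactly supported Borel probability measure ν on Ω with W₁(ν, ν₀) < δ, every θ ∈ 𝕋^d and every n ≥ n̄, one has ν^ℤ{ω ∈ X : |(1/n) ∑_{j=0}^{n−1} φ(f^j(ω, θ)) − ∫ φ d(ν^ℤ × m)| ≥ ε} < e^{−cn}. -/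

import Mathlib

open MeasureTheory Filter Topology

noncomputable section

/-- The `d`-dimensional torus `𝕋^d = (ℝ/ℤ)^d`; `volume` on it is the Haar
probability measure `m`. -/
abbrev Td (d : ℕ) : Type := Fin d → AddCircle (1 : ℝ)

instance : IsProbabilityMeasure (volume : Measure (AddCircle (1:ℝ))) :=
  ⟨by rw [AddCircle.measure_univ]; norm_num⟩

/-- `P` is the Bernoulli product measure `ν^ι` on `ι → Ω`. -/
def IsBernoulli {Ω ι : Type*} [MeasurableSpace Ω] (ν : Measure Ω)
    (P : Measure (ι → Ω)) : Prop :=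
  IsProbabilityMeasure P ∧
    ∀ (s : Finset ι) (E : ι → Set Ω), (∀ i, MeasurableSet (E i)) →
      P {ω | ∀ i ∈ s, ω i ∈ E i} = ∏ i ∈ s, ν (E i)

/-- The two-sided Bernoulli shift `(σω)_n = ω_{n+1}`. -/
def shiftZ (Ω : Type*) : (ℤ → Ω) → (ℤ → Ω) := fun ω n => ω (n + 1)

/-- The Wasserstein (Kantorovich-Rubinstein) distance
`W₁(ν, ν') = sup {∫ g d(ν − ν') : g Lipschitz with constant ≤ 1}`. -/
def W1 {M : Type*} [MeasurableSpace M] [MetricSpace M]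
    (ν ν' : Measure M) : ℝ :=
  sSup {r | ∃ g : M → ℝ, LipschitzWith 1 g ∧
    r = (∫ x, g x ∂ν) - ∫ x, g x ∂ν'}

/-- The skew-product `(ω, θ) ↦ (σω, θ + 𝔞(ω₀))`. -/
def skewProduct {Ω : Type*} {d : ℕ} (𝔞 : Ω → Td d) (p : (ℤ → Ω) × Td d) : (ℤ → Ω) × Td d :=
  (shiftZ Ω p.1, p.2 + 𝔞 (p.1 0))

/-- Concatenation at `q`: the coordinates below `q` are those of the first sequence, the
remaining ones are the nonnegative coordinates of the second. -/
def glue {Ω : Type*} (q : ℕ) (x : (ℤ → Ω) × (ℤ → Ω)) : ℤ → Ω :=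
  fun i => if i < q then x.1 i else x.2 (i - q)

/-- The observable `φ` only depends on the coordinates of `ω` with index in `s`. -/
def DependsOnCoords {Ω T β : Type*} (φ : (ℤ → Ω) × T → β) (s : Set ℤ) : Prop :=
  ∀ (ω ω' : ℤ → Ω) (θ : T), (∀ i ∈ s, ω i = ω' i) → φ (ω, θ) = φ (ω', θ)

section Basic

variable {Ω : Type*} {d : ℕ}

lemma DependsOnCoords.mono {T β : Type*} {φ : (ℤ → Ω) × T → β} {s t : Set ℤ}
    (h : DependsOnCoords φ s) (hst : s ⊆ t) : DependsOnCoords φ t :=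
  fun ω ω' θ hω => h ω ω' θ fun i hi => hω i (hst hi)

lemma skewProduct_iterate (𝔞 : Ω → Td d) (n : ℕ) (ω : ℤ → Ω) (θ : Td d) :
    (skewProduct 𝔞)^[n] (ω, θ) =
      (fun i => ω (i + n), θ + ∑ j ∈ Finset.range n, 𝔞 (ω j)) := by
  induction n with
  | zero => simp
  | succ n ih =>
    rw [Function.iterate_succ_apply', ih, skewProduct, Finset.sum_range_succ]
    refine Prod.ext ?_ ?_
    · funext i
      simp only [shiftZ]
      congr 1
      push_cast
      ring
    · simp [add_assoc]

lemma DependsOnCoords.comp_iterate {β : Type*} {φ : (ℤ → Ω) × Td d → β} {s t : Set ℤ}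
    (h : DependsOnCoords φ s) (𝔞 : Ω → Td d) (n : ℕ) (hs : ∀ i ∈ s, i + n ∈ t)
    (ht : Set.Ico 0 (n : ℤ) ⊆ t) :
    DependsOnCoords (fun p => φ ((skewProduct 𝔞)^[n] p)) t := by
  intro ω ω' θ hω
  simp only [skewProduct_iterate]
  have hsum : ∑ j ∈ Finset.range n, 𝔞 (ω j) = ∑ j ∈ Finset.range n, 𝔞 (ω' j) := by
    refine Finset.sum_congr rfl fun j hj => ?_
    rw [hω j (ht ⟨by positivity, by exact_mod_cast Finset.mem_range.1 hj⟩)]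
  rw [hsum]
  exact h _ _ _ fun i hi => hω _ (hs i hi)

lemma DependsOnCoords.glue_left {T β : Type*} {φ : (ℤ → Ω) × T → β} {q : ℕ}
    (h : DependsOnCoords φ (Set.Ico 0 q)) (x : (ℤ → Ω) × (ℤ → Ω)) (θ : T) :
    φ (glue q x, θ) = φ (x.1, θ) :=
  h _ _ _ fun i hi => by simp [glue, hi.2]

lemma DependsOnCoords.iterate_glue {β : Type*} {φ : (ℤ → Ω) × Td d → β}
    (h : DependsOnCoords φ (Set.Ici 0)) (𝔞 : Ω → Td d) (q : ℕ) (x : (ℤ → Ω) × (ℤ → Ω))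
    (θ : Td d) :
    φ ((skewProduct 𝔞)^[q] (glue q x, θ)) =
      φ (x.2, θ + ∑ j ∈ Finset.range q, 𝔞 (x.1 j)) := by
  rw [skewProduct_iterate]
  have hsum : ∑ j ∈ Finset.range q, 𝔞 (glue q x j) = ∑ j ∈ Finset.range q, 𝔞 (x.1 j) := by
    refine Finset.sum_congr rfl fun j hj => ?_
    have : (j : ℤ) < q := by exact_mod_cast Finset.mem_range.1 hj
    simp [glue, this]
  rw [hsum]
  refine h _ _ _ fun i hi => ?_
  have : ¬ (i + q < (q : ℤ)) := by simpa using hi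
  simp [glue, this]

lemma continuous_skewProduct [TopologicalSpace Ω] {𝔞 : Ω → Td d} (h𝔞 : Continuous 𝔞) :
    Continuous (skewProduct 𝔞) := by
  unfold skewProduct shiftZ
  fun_prop

lemma measurable_glue [MeasurableSpace Ω] (q : ℕ) : Measurable (glue (Ω := Ω) q) := by
  refine measurable_pi_lambda _ fun i => ?_
  unfold glue
  split_ifs <;> fun_prop

lemma IsBernoulli.eq_infinitePi {ι : Type*} [MeasurableSpace Ω] {ν : Measure Ω}
    [IsProbabilityMeasure ν] {P : Measure (ι → Ω)} (hP : IsBernoulli ν P) :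
    P = Measure.infinitePi (fun _ => ν) :=
  Measure.eq_infinitePi _ fun s t ht => by
    rw [← hP.2 s t ht]
    rfl

lemma IsBernoulli.measurePreserving_glue [MeasurableSpace Ω] {ν : Measure Ω}
    [IsProbabilityMeasure ν] {P : Measure (ℤ → Ω)} (hP : IsBernoulli ν P) (q : ℕ) :
    MeasurePreserving (glue q) (P.prod P) P := by
  have := hP.1
  refine ⟨measurable_glue q, ?_⟩
  conv_rhs => rw [hP.eq_infinitePi]
  refine Measure.eq_infinitePi _ fun s t ht => ?_
  rw [Measure.map_apply (measurable_glue q) (.pi s.countable_toSet fun i _ => ht i)]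
  have hset : glue q ⁻¹' (Set.pi (s : Set ℤ) t) =
      {ω : ℤ → Ω | ∀ i ∈ s.filter (· < (q : ℤ)), ω i ∈ t i} ×ˢ
      {ω : ℤ → Ω | ∀ i ∈ (s.filter (¬ · < (q : ℤ))).map
        ((Equiv.subRight (q : ℤ)).toEmbedding), ω i ∈ t (i + q)} := by
    ext x
    simp only [Set.mem_preimage, Set.mem_pi, Finset.mem_coe, glue, Set.mem_prod,
      Set.mem_ofPred_eq, Finset.mem_filter, Finset.forall_mem_map, Equiv.toEmbedding_apply,
      Equiv.subRight_apply, sub_add_cancel, and_imp]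
    constructor
    · intro h
      refine ⟨fun i hi hq => ?_, fun i hi hq => ?_⟩
      · simpa [hq] using h i hi
      · simpa [hq] using h i hi
    · rintro ⟨h1, h2⟩ i hi
      split_ifs with hq
      · exact h1 i hi hq
      · exact h2 i hi hq
  rw [hset, Measure.prod_prod, hP.2 _ _ ht, hP.2 _ (fun i => t (i + q)) fun i => ht _,
    Finset.prod_map]
  simp only [Equiv.toEmbedding_apply, Equiv.subRight_apply, sub_add_cancel]
  exact Finset.prod_filter_mul_prod_filter_not s _ _

end Basic

lemma integrable_of_continuous_of_bound {Y E : Type*} [TopologicalSpace Y]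
    [SecondCountableTopology Y] [MeasurableSpace Y] [OpensMeasurableSpace Y]
    [NormedAddCommGroup E] {μ : Measure Y} [IsFiniteMeasure μ] {g : Y → E} (hg : Continuous g)
    {C : ℝ} (hC : ∀ y, ‖g y‖ ≤ C) : Integrable g μ := by
  refine .of_bound ?_ C (.of_forall hC)
  exact hg.aestronglyMeasurable

section Moments

variable {Ω : Type*} [TopologicalSpace Ω] [SecondCountableTopology Ω] [MeasurableSpace Ω]
  [BorelSpace Ω] {d : ℕ} {𝔞 : Ω → Td d} {ν : Measure Ω} [IsProbabilityMeasure ν]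
  {P : Measure (ℤ → Ω)}

lemma IsBernoulli.integral_exp_block_sum_le (hP : IsBernoulli ν P) (h𝔞 : Continuous 𝔞) {q : ℕ}
    {V : (ℤ → Ω) × Td d → ℝ} (hV : Continuous V) {D m t : ℝ} (hD : ∀ p, |V p| ≤ D)
    (hdep : DependsOnCoords V (Set.Ico 0 q)) (hm : ∀ θ, ∫ ω, V (ω, θ) ∂P ≤ m)
    (ht : 0 ≤ t) (htD : t * D ≤ 1) (B : ℕ) (θ : Td d) :
    ∫ ω, Real.exp (t * ∑ b ∈ Finset.range B, V ((skewProduct 𝔞)^[q * b] (ω, θ))) ∂P ≤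
      Real.exp (B * (t * m + t ^ 2 * D ^ 2)) := by
  have := hP.1
  have hfc : Continuous (skewProduct 𝔞) := continuous_skewProduct h𝔞
  have htV : ∀ p, |t * V p| ≤ 1 := fun p => by
    rw [abs_mul, abs_of_nonneg ht]
    exact (mul_le_mul_of_nonneg_left (hD p) ht).trans htD
  induction B generalizing θ with
  | zero => simp
  | succ B ih =>
    set R : (ℤ → Ω) × Td d → ℝ := fun p =>
      Real.exp (t * ∑ b ∈ Finset.range B, V ((skewProduct 𝔞)^[q * b] p)) with hR
    have hRc : Continuous R := by
      refine Real.continuous_exp.comp (continuous_const.mul (continuous_finsetSum _ fun b _ => ?_))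
      exact hV.comp (hfc.iterate _)
    have hRb : ∀ p, ‖R p‖ ≤ Real.exp B := fun p => by
      rw [Real.norm_eq_abs, Real.abs_exp, Finset.mul_sum]
      refine Real.exp_le_exp.2 ((Finset.sum_le_card_nsmul _ _ 1 fun b _ =>
        (le_abs_self _).trans (htV _)).trans ?_)
      simp
    have hRdep : DependsOnCoords R (Set.Ici 0) := by
      intro ω ω' θ h
      simp only [hR]
      congr 2
      refine Finset.sum_congr rfl fun b _ => ?_
      exact hdep.comp_iterate 𝔞 (q * b) (t := Set.Ici 0)
        (fun i hi => by
          have := hi.1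
          simp only [Set.mem_Ici]
          positivity)
        (fun i hi => hi.1) ω ω' θ h
    have hstep : ∀ ω, Real.exp (t * ∑ b ∈ Finset.range (B + 1),
        V ((skewProduct 𝔞)^[q * b] (ω, θ))) =
        Real.exp (t * V (ω, θ)) * R ((skewProduct 𝔞)^[q] (ω, θ)) := fun ω => by
      rw [Finset.sum_range_succ', mul_add, Real.exp_add, mul_comm]
      simp only [hR, mul_zero, Function.iterate_zero, id, ← Function.iterate_add_apply, mul_add,
        mul_one]
    simp only [hstep]
    have hV1 : ∀ p, ‖Real.exp (t * V p)‖ ≤ Real.exp 1 := fun p => by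
      rw [Real.norm_eq_abs, Real.abs_exp]
      exact Real.exp_le_exp.2 ((le_abs_self _).trans (htV _))
    have hVint : Integrable (fun ω => Real.exp (t * V (ω, θ))) P :=
      integrable_of_continuous_of_bound (by fun_prop) fun ω => hV1 _
    have hRit : Continuous fun ω : ℤ → Ω => R ((skewProduct 𝔞)^[q] (ω, θ)) :=
      hRc.comp ((hfc.iterate _).comp (by fun_prop))
    rw [← (hP.measurePreserving_glue q).map_eq, integral_map (measurable_glue q).aemeasurable
      (by
        refine Continuous.aestronglyMeasurable ?_
        exact Continuous.mul (by fun_prop) hRit)]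
    have hsplit : ∀ x : (ℤ → Ω) × (ℤ → Ω), Real.exp (t * V (glue q x, θ)) *
        R ((skewProduct 𝔞)^[q] (glue q x, θ)) = Real.exp (t * V (x.1, θ)) *
        R (x.2, θ + ∑ j ∈ Finset.range q, 𝔞 (x.1 j)) := fun x => by
      rw [hdep.glue_left, hRdep.iterate_glue]
    simp only [hsplit]
    have hpair : Continuous fun x : (ℤ → Ω) × (ℤ → Ω) => Real.exp (t * V (x.1, θ)) *
        R (x.2, θ + ∑ j ∈ Finset.range q, 𝔞 (x.1 j)) := by fun_prop
    have hint : Integrable (fun x : (ℤ → Ω) × (ℤ → Ω) => Real.exp (t * V (x.1, θ)) *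
        R (x.2, θ + ∑ j ∈ Finset.range q, 𝔞 (x.1 j))) (P.prod P) :=
      integrable_of_continuous_of_bound hpair (C := Real.exp 1 * Real.exp B) fun x => by
        rw [norm_mul]
        exact mul_le_mul (hV1 _) (hRb _) (norm_nonneg _) (Real.exp_pos _).le
    rw [integral_prod _ hint]
    set κ := Real.exp (B * (t * m + t ^ 2 * D ^ 2)) with hκ
    calc ∫ ω, ∫ ω', Real.exp (t * V (ω, θ)) *
          R (ω', θ + ∑ j ∈ Finset.range q, 𝔞 (ω j)) ∂P ∂P
        ≤ ∫ ω, Real.exp (t * V (ω, θ)) * κ ∂P := by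
          refine integral_mono hint.integral_prod_left (hVint.mul_const _) fun ω => ?_
          simp only
          rw [integral_const_mul]
          exact mul_le_mul_of_nonneg_left (ih _) (Real.exp_pos _).le
      _ = (∫ ω, Real.exp (t * V (ω, θ)) ∂P) * κ := integral_mul_const _ _
      _ ≤ Real.exp (t * m + t ^ 2 * D ^ 2) * κ := by
          refine mul_le_mul_of_nonneg_right ?_ (Real.exp_pos _).le
          have hVi : Integrable (fun ω => V (ω, θ)) P :=
            integrable_of_continuous_of_bound (by fun_prop) fun ω => hD _
          calc ∫ ω, Real.exp (t * V (ω, θ)) ∂P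
              ≤ ∫ ω, (t * V (ω, θ) + (1 + t ^ 2 * D ^ 2)) ∂P := by
                refine integral_mono hVint ((hVi.const_mul t).add (integrable_const _))
                  fun ω => ?_
                have h1 := (abs_le.1 (Real.abs_exp_sub_one_sub_id_le (htV (ω, θ)))).2
                have h2 : (t * V (ω, θ)) ^ 2 ≤ t ^ 2 * D ^ 2 := by
                  rw [mul_pow]
                  exact mul_le_mul_of_nonneg_left (sq_le_sq.2 ((hD _).trans (le_abs_self D)))
                    (sq_nonneg t)
                simp only
                linarith
            _ = t * (∫ ω, V (ω, θ) ∂P) + (1 + t ^ 2 * D ^ 2) := by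
                rw [integral_add (hVi.const_mul t) (integrable_const _), integral_const_mul]
                simp
            _ ≤ t * m + t ^ 2 * D ^ 2 + 1 := by
                have := mul_le_mul_of_nonneg_left (hm θ) ht
                linarith
            _ ≤ _ := Real.add_one_le_exp _
      _ = _ := by
          rw [hκ, ← Real.exp_add]
          congr 1
          push_cast
          ring

lemma IsBernoulli.measure_block_sum_ge_le (hP : IsBernoulli ν P) (h𝔞 : Continuous 𝔞) {q : ℕ}
    {V : (ℤ → Ω) × Td d → ℝ} (hV : Continuous V) {D m t : ℝ} (hD : ∀ p, |V p| ≤ D)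
    (hdep : DependsOnCoords V (Set.Ico 0 q)) (hm : ∀ θ, ∫ ω, V (ω, θ) ∂P ≤ m)
    (ht : 0 ≤ t) (htD : t * D ≤ 1) (htm : t * D ^ 2 ≤ m / 2) (B : ℕ) (θ : Td d) :
    P.real {ω | B * (2 * m) ≤ ∑ b ∈ Finset.range B, V ((skewProduct 𝔞)^[q * b] (ω, θ))} ≤
      Real.exp (-(B * (t * m / 2))) := by
  have := hP.1
  have hfc : Continuous (skewProduct 𝔞) := continuous_skewProduct h𝔞
  have hc : Continuous fun ω : ℤ → Ω => Real.exp (t * ∑ b ∈ Finset.range B,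
      V ((skewProduct 𝔞)^[q * b] (ω, θ))) := by
    refine Real.continuous_exp.comp (continuous_const.mul (continuous_finsetSum _ fun b _ => ?_))
    exact hV.comp ((hfc.iterate _).comp (by fun_prop))
  have hint : Integrable (fun ω => Real.exp (t * ∑ b ∈ Finset.range B,
      V ((skewProduct 𝔞)^[q * b] (ω, θ)))) P := by
    refine integrable_of_continuous_of_bound hc (C := Real.exp (t * (B * D))) fun ω => ?_
    rw [Real.norm_eq_abs, Real.abs_exp]
    refine Real.exp_le_exp.2 (mul_le_mul_of_nonneg_left ?_ ht)
    refine (Finset.sum_le_card_nsmul _ _ D fun b _ => (le_abs_self _).trans (hD _)).trans ?_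
    simp
  refine (ProbabilityTheory.measure_ge_le_exp_mul_mgf (B * (2 * m)) ht hint).trans ?_
  refine (mul_le_mul_of_nonneg_left
    (hP.integral_exp_block_sum_le h𝔞 hV hD hdep hm ht htD B θ) (Real.exp_pos _).le).trans ?_
  rw [← Real.exp_add]
  refine Real.exp_le_exp.2 ?_
  have h1 : t * (t * D ^ 2) ≤ t * (m / 2) := mul_le_mul_of_nonneg_left htm ht
  have h2 : (B : ℝ) * (t * (t * D ^ 2)) ≤ B * (t * (m / 2)) :=
    mul_le_mul_of_nonneg_left h1 (Nat.cast_nonneg B)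
  linarith

end Moments

section Fourier

open UnitAddTorus

lemma integral_mFourier_eq_zero {d : ℕ} {k : Fin d → ℤ} (hk : k ≠ 0) :
    ∫ θ : Td d, mFourier k θ = 0 := by
  obtain ⟨i, hi⟩ := Function.ne_iff.1 hk
  let x : Td d := Pi.single i (((1 : ℝ) / 2 / (k i) : ℝ) : AddCircle (1 : ℝ))
  have hx : ∀ θ : Td d, mFourier k (θ + x) = -mFourier k θ := fun θ => by
    simp only [mFourier, ContinuousMap.coe_mk]
    rw [← Finset.mul_prod_erase _ _ (Finset.mem_univ i),
      ← Finset.mul_prod_erase _ (fun j => fourier (k j) (θ j)) (Finset.mem_univ i), ← neg_mul]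
    congr 1
    · simp only [x, Pi.add_apply, Pi.single_eq_same]
      exact fourier_add_half_inv_index hi one_pos (θ i)
    · refine Finset.prod_congr rfl fun j hj => ?_
      simp [x, Pi.single_eq_of_ne (Finset.ne_of_mem_erase hj)]
  have h := integral_add_right_eq_self (μ := (volume : Measure (Td d)))
    (fun θ => mFourier k θ) x
  simp only [hx, integral_neg] at h
  exact self_eq_neg.1 h.symm

lemma mFourier_apply_add {d : ℕ} (k : Fin d → ℤ) (x y : Td d) :
    mFourier k (x + y) = mFourier k x * mFourier k y := by
  simp [mFourier, fourier_apply, smul_add, AddCircle.toCircle_add, Finset.prod_mul_distrib]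

lemma norm_mFourier_apply {d : ℕ} (k : Fin d → ℤ) (x : Td d) : ‖mFourier k x‖ = 1 := by
  simp only [mFourier, ContinuousMap.coe_mk, norm_prod, fourier_apply, Circle.norm_coe,
    Finset.prod_const_one]

end Fourier

section Equidistribution

open UnitAddTorus

variable {Ω : Type*} [TopologicalSpace Ω] [SecondCountableTopology Ω] [MeasurableSpace Ω]
  [BorelSpace Ω] {d : ℕ} {𝔞 : Ω → Td d} {ν : Measure Ω} [IsProbabilityMeasure ν]
  {P : Measure (ℤ → Ω)}

/-- A character with mean one along `𝔞` would be a nonconstant invariant function. -/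
lemma integral_mFourier_ne_one [IsProbabilityMeasure P] (h𝔞 : Continuous 𝔞)
    (herg : Ergodic (skewProduct 𝔞) (P.prod (volume : Measure (Td d)))) {k : Fin d → ℤ}
    (hk : k ≠ 0) : ∫ ω, mFourier k (𝔞 (ω 0)) ∂P ≠ 1 := by
  intro h
  have hc : Continuous fun ω : ℤ → Ω => mFourier k (𝔞 (ω 0)) :=
    (mFourier k).continuous.comp (by fun_prop)
  have hi : Integrable (fun ω : ℤ → Ω => mFourier k (𝔞 (ω 0))) P :=
    integrable_of_continuous_of_bound hc fun ω => (norm_mFourier_apply k _).le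
  have hire : Integrable (fun ω : ℤ → Ω => (mFourier k (𝔞 (ω 0))).re) P := hi.re
  have hre : ∫ ω, (1 - (mFourier k (𝔞 (ω 0))).re) ∂P = 0 := by
    rw [integral_sub (integrable_const _) hire]
    have : ∫ ω, (mFourier k (𝔞 (ω 0))).re ∂P = 1 := by
      have := integral_re hi
      simp only [RCLike.re_eq_complex_re] at this
      rw [this, h, Complex.one_re]
    rw [this]
    simp
  have hle : ∀ ω : ℤ → Ω, (mFourier k (𝔞 (ω 0))).re ≤ 1 := fun ω =>
    (Complex.re_le_norm _).trans (norm_mFourier_apply k _).le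
  have hae : ∀ᵐ ω ∂P, mFourier k (𝔞 (ω 0)) = 1 := by
    have := (integral_eq_zero_iff_of_nonneg (fun ω => sub_nonneg.2 (hle ω))
      ((integrable_const _).sub hire)).1 hre
    filter_upwards [this] with ω hω
    have hre1 : (mFourier k (𝔞 (ω 0))).re = 1 := by
      simp only [Pi.zero_apply] at hω
      linarith
    have hn := norm_mFourier_apply k (𝔞 (ω 0))
    have hsq := Complex.sq_norm (mFourier k (𝔞 (ω 0)))
    rw [hn, Complex.normSq_apply, hre1] at hsq
    refine Complex.ext hre1 ?_
    rw [Complex.one_im]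
    nlinarith
  have hinv : (fun p : (ℤ → Ω) × Td d => mFourier k p.2) ∘ skewProduct 𝔞
      =ᵐ[P.prod volume] fun p => mFourier k p.2 := by
    have := Measure.quasiMeasurePreserving_fst (μ := P) (ν := (volume : Measure (Td d)))
      |>.ae hae
    filter_upwards [this] with p hp
    simp only [Function.comp_apply, skewProduct, mFourier_apply_add, hp, mul_one]
  obtain ⟨c, hcst⟩ := herg.ae_eq_const_of_ae_eq_comp_ae
    (Continuous.aestronglyMeasurable (by fun_prop)) hinv
  have hcz : c = 0 := by
    have h1 : ∫ p, mFourier k p.2 ∂(P.prod (volume : Measure (Td d))) = c := by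
      rw [integral_congr_ae hcst]
      simp
    have h2 := integral_fun_snd (μ := P) (ν := (volume : Measure (Td d)))
      (fun θ => mFourier k θ)
    rw [h1, integral_mFourier_eq_zero hk] at h2
    simpa using h2
  obtain ⟨p, hp⟩ := hcst.exists
  have hn := norm_mFourier_apply k p.2
  rw [show mFourier k p.2 = 0 from hp.trans hcz, norm_zero] at hn
  exact zero_ne_one hn

lemma IsBernoulli.integral_mFourier_sum (hP : IsBernoulli ν P) (h𝔞 : Continuous 𝔞)
    (k : Fin d → ℤ) (n : ℕ) :
    ∫ ω, mFourier k (∑ j ∈ Finset.range n, 𝔞 (ω j)) ∂P =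
      (∫ ω, mFourier k (𝔞 (ω 0)) ∂P) ^ n := by
  have := hP.1
  induction n with
  | zero => simp [mFourier]
  | succ n ih =>
    rw [← (hP.measurePreserving_glue 1).map_eq, integral_map (measurable_glue 1).aemeasurable
      (Continuous.aestronglyMeasurable (by fun_prop)), pow_succ', (hP.measurePreserving_glue 1).map_eq,
      ← ih, ← integral_prod_mul]
    refine integral_congr_ae (.of_forall fun x => ?_)
    have hs : ∑ j ∈ Finset.range (n + 1), 𝔞 (glue 1 x j) =
        𝔞 (x.1 0) + ∑ j ∈ Finset.range n, 𝔞 (x.2 j) := by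
      rw [Finset.sum_range_succ', add_comm]
      congr 1
      refine Finset.sum_congr rfl fun j _ => ?_
      have : ¬ ((j : ℤ) + 1 < 1) := by omega
      simp [glue, this]
    simp only [hs, mFourier_apply_add]

/-- Cesàro averages of continuous observables along the random walk driven by `𝔞` converge
uniformly in the starting point. -/
lemma IsBernoulli.exists_norm_sum_integral_sub_le (hP : IsBernoulli ν P) (h𝔞 : Continuous 𝔞)
    (herg : Ergodic (skewProduct 𝔞) (P.prod (volume : Measure (Td d)))) (ψ : C(Td d, ℂ)) {η : ℝ}
    (hη : 0 < η) : ∃ p₀ : ℕ, ∀ p ≥ p₀, ∀ θ : Td d,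
      ‖∑ i ∈ Finset.range p, ((∫ ω, ψ (θ + ∑ j ∈ Finset.range i, 𝔞 (ω j)) ∂P) -
        ∫ θ', ψ θ')‖ ≤ η * p := by
  have := hP.1
  have hwalk : ∀ (χ : C(Td d, ℂ)) (θ : Td d) (i : ℕ),
      Integrable (fun ω : ℤ → Ω => χ (θ + ∑ j ∈ Finset.range i, 𝔞 (ω j))) P := fun χ θ i =>
    integrable_of_continuous_of_bound (by fun_prop) fun ω => χ.norm_coe_le_norm _
  have hT : ∀ χ : C(Td d, ℂ), Integrable (fun θ => χ θ) (volume : Measure (Td d)) := fun χ =>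
    integrable_of_continuous_of_bound χ.continuous χ.norm_coe_le_norm
  have hspan : ∀ χ ∈ Submodule.span ℂ (Set.range (mFourier (d := Fin d))), ∀ η > (0 : ℝ),
      ∃ p₀ : ℕ, ∀ p ≥ p₀, ∀ θ : Td d,
      ‖∑ i ∈ Finset.range p, ((∫ ω, χ (θ + ∑ j ∈ Finset.range i, 𝔞 (ω j)) ∂P) -
        ∫ θ', χ θ')‖ ≤ η * p := by
    intro χ hχ
    induction hχ using Submodule.span_induction with
    | mem χ hχ =>
      obtain ⟨k, rfl⟩ := hχ
      intro η hη
      by_cases hk : k = 0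
      · subst hk
        refine ⟨0, fun p _ θ => ?_⟩
        simp only [mFourier_zero, ContinuousMap.one_apply, integral_const, probReal_univ,
          one_smul, sub_self, Finset.sum_const_zero, norm_zero]
        positivity
      set lam := ∫ ω, mFourier k (𝔞 (ω 0)) ∂P with hlam
      have hne : lam ≠ 1 := integral_mFourier_ne_one h𝔞 herg hk
      have hpos : 0 < ‖lam - 1‖ := norm_pos_iff.2 (sub_ne_zero.2 hne)
      have hle : ‖lam‖ ≤ 1 := by
        refine (norm_integral_le_of_norm_le_const (C := 1)
          (.of_forall fun ω => (norm_mFourier_apply k _).le)).trans ?_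
        simp
      obtain ⟨p₀, hp₀⟩ := exists_nat_ge (2 / ‖lam - 1‖ / η)
      refine ⟨p₀, fun p hp θ => ?_⟩
      rw [integral_mFourier_eq_zero hk]
      simp only [mFourier_apply_add, integral_const_mul, hP.integral_mFourier_sum h𝔞, sub_zero,
        ← Finset.mul_sum, ← hlam]
      rw [geom_sum_eq hne, norm_mul, norm_mFourier_apply, one_mul, norm_div]
      have h2 : ‖lam ^ p - 1‖ ≤ 2 := by
        refine (norm_sub_le _ _).trans ?_
        rw [norm_pow, norm_one]
        linarith [pow_le_one₀ (n := p) (norm_nonneg _) hle]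
      calc ‖lam ^ p - 1‖ / ‖lam - 1‖ ≤ 2 / ‖lam - 1‖ := by gcongr
        _ ≤ p * η := (div_le_iff₀ hη).1 (hp₀.trans (by exact_mod_cast hp))
        _ = η * p := mul_comm _ _
    | zero =>
      intro η hη
      refine ⟨0, fun p _ θ => ?_⟩
      simp only [ContinuousMap.zero_apply, integral_zero, sub_self, Finset.sum_const_zero,
        norm_zero]
      positivity
    | add χ₁ χ₂ _ _ h₁ h₂ =>
      intro η hη
      obtain ⟨p₁, hp₁⟩ := h₁ (η / 2) (by positivity)
      obtain ⟨p₂, hp₂⟩ := h₂ (η / 2) (by positivity)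
      refine ⟨max p₁ p₂, fun p hp θ => ?_⟩
      have e₁ := hp₁ p ((le_max_left _ _).trans hp) θ
      have e₂ := hp₂ p ((le_max_right _ _).trans hp) θ
      simp only [ContinuousMap.add_apply]
      rw [integral_add (hT χ₁) (hT χ₂)]
      simp only [fun i => integral_add (hwalk χ₁ θ i) (hwalk χ₂ θ i), add_sub_add_comm,
        Finset.sum_add_distrib]
      refine (norm_add_le _ _).trans ?_
      linarith
    | smul c χ _ h =>
      intro η hη
      obtain ⟨p₀, hp₀⟩ := h (η / (‖c‖ + 1)) (by positivity)
      refine ⟨p₀, fun p hp θ => ?_⟩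
      simp only [ContinuousMap.smul_apply, smul_eq_mul, integral_const_mul, ← mul_sub,
        ← Finset.mul_sum]
      rw [norm_mul]
      calc _ ≤ ‖c‖ * (η / (‖c‖ + 1) * p) :=
            mul_le_mul_of_nonneg_left (hp₀ p hp θ) (norm_nonneg _)
        _ = (‖c‖ / (‖c‖ + 1)) * (η * p) := by ring
        _ ≤ 1 * (η * p) := by
            gcongr
            exact (div_le_one (by positivity)).2 (by linarith)
        _ = η * p := one_mul _
  have hmem : ψ ∈ closure (Submodule.span ℂ (Set.range (mFourier (d := Fin d))) :
      Set C(Td d, ℂ)) := by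
    rw [← Submodule.topologicalClosure_coe, span_mFourier_closure_eq_top]
    trivial
  obtain ⟨χ, hχ, hdist⟩ := Metric.mem_closure_iff.1 hmem (η / 3) (by positivity)
  obtain ⟨p₀, hp₀⟩ := hspan χ hχ (η / 3) (by positivity)
  have hclose : ∀ θ, ‖ψ θ - χ θ‖ ≤ η / 3 := fun θ => by
    rw [← dist_eq_norm]
    exact (ContinuousMap.dist_apply_le_dist θ).trans hdist.le
  refine ⟨p₀, fun p hp θ => ?_⟩
  have hterm : ∀ i ∈ Finset.range p,
      ‖((∫ ω, ψ (θ + ∑ j ∈ Finset.range i, 𝔞 (ω j)) ∂P) - ∫ θ', ψ θ') -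
        ((∫ ω, χ (θ + ∑ j ∈ Finset.range i, 𝔞 (ω j)) ∂P) - ∫ θ', χ θ')‖ ≤ 2 * (η / 3) := by
    intro i _
    rw [sub_sub_sub_comm, ← integral_sub (hwalk ψ θ i) (hwalk χ θ i),
      ← integral_sub (hT ψ) (hT χ)]
    refine (norm_sub_le _ _).trans ?_
    have e₁ := norm_integral_le_of_norm_le_const (μ := P)
      (.of_forall fun ω : ℤ → Ω => hclose (θ + ∑ j ∈ Finset.range i, 𝔞 (ω j)))
    have e₂ := norm_integral_le_of_norm_le_const (μ := (volume : Measure (Td d)))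
      (.of_forall hclose)
    simp only [probReal_univ, mul_one] at e₁ e₂
    linarith
  have hsum := norm_sum_le_of_le _ hterm
  rw [Finset.sum_sub_distrib] at hsum
  simp only [Finset.sum_const, Finset.card_range, nsmul_eq_mul] at hsum
  have h₁ := hp₀ p hp θ
  have h₂ := norm_le_norm_add_norm_sub'
    (∑ i ∈ Finset.range p, ((∫ ω, ψ (θ + ∑ j ∈ Finset.range i, 𝔞 (ω j)) ∂P) - ∫ θ', ψ θ'))
    (∑ i ∈ Finset.range p, ((∫ ω, χ (θ + ∑ j ∈ Finset.range i, 𝔞 (ω j)) ∂P) - ∫ θ', χ θ'))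
  linarith

/-- Expected ergodic sums of an observable of the nonnegative coordinates are uniformly close to
the space average. -/
lemma IsBernoulli.exists_abs_sum_integral_sub_le (hP : IsBernoulli ν P) (h𝔞 : Continuous 𝔞)
    (herg : Ergodic (skewProduct 𝔞) (P.prod (volume : Measure (Td d))))
    {φ : (ℤ → Ω) × Td d → ℝ} (hφ : Continuous φ) {C : ℝ} (hC : ∀ p, |φ p| ≤ C)
    (hdep : DependsOnCoords φ (Set.Ici 0)) {η : ℝ} (hη : 0 < η) :
    ∃ p₀ : ℕ, ∀ p ≥ p₀, ∀ θ : Td d,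
      |∑ i ∈ Finset.range p, ((∫ ω, φ ((skewProduct 𝔞)^[i] (ω, θ)) ∂P) -
        ∫ x, φ x ∂(P.prod volume))| ≤ η * p := by
  have := hP.1
  have hfc : Continuous (skewProduct 𝔞) := continuous_skewProduct h𝔞
  let ψ : C(Td d, ℂ) := ⟨fun θ => ((∫ ω, φ (ω, θ) ∂P : ℝ) : ℂ), by
    refine Complex.continuous_ofReal.comp ?_
    exact continuous_of_dominated (bound := fun _ => C)
      (fun θ => Continuous.aestronglyMeasurable (by fun_prop))
      (fun θ => .of_forall fun ω => hC _) (integrable_const _)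
      (.of_forall fun ω => by fun_prop)⟩
  obtain ⟨p₀, hp₀⟩ := hP.exists_norm_sum_integral_sub_le h𝔞 herg ψ hη
  refine ⟨p₀, fun p hp θ => ?_⟩
  have hmean : ∫ θ', ψ θ' = ((∫ x, φ x ∂(P.prod (volume : Measure (Td d))) : ℝ) : ℂ) := by
    rw [integral_prod_symm _ (integrable_of_continuous_of_bound hφ hC)]
    exact integral_ofReal
  have hwalk : ∀ i, ∫ ω, ψ (θ + ∑ j ∈ Finset.range i, 𝔞 (ω j)) ∂P =
      ((∫ ω, φ ((skewProduct 𝔞)^[i] (ω, θ)) ∂P : ℝ) : ℂ) := fun i => by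
    have hcomp : Continuous fun ω : ℤ → Ω => φ ((skewProduct 𝔞)^[i] (ω, θ)) :=
      hφ.comp ((hfc.iterate _).comp (by fun_prop))
    have hpair : Continuous fun x : (ℤ → Ω) × (ℤ → Ω) =>
        φ (x.2, θ + ∑ j ∈ Finset.range i, 𝔞 (x.1 j)) := by fun_prop
    conv_rhs => rw [← (hP.measurePreserving_glue i).map_eq]
    rw [integral_map (measurable_glue i).aemeasurable hcomp.aestronglyMeasurable]
    simp only [hdep.iterate_glue]
    rw [integral_prod _ (integrable_of_continuous_of_bound hpair fun x => hC _)]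
    exact integral_ofReal
  have h := hp₀ p hp θ
  rw [hmean] at h
  simp only [hwalk, ← Complex.ofReal_sub, ← Complex.ofReal_sum] at h
  rwa [Complex.norm_real, Real.norm_eq_abs] at h

end Equidistribution

section Wasserstein

variable {Ω : Type*} [MetricSpace Ω] [MeasurableSpace Ω]

lemma bddAbove_W1 [OpensMeasurableSpace Ω] [SecondCountableTopology Ω] {ν ν' : Measure Ω}
    [IsProbabilityMeasure ν] [IsProbabilityMeasure ν'] (hν : ∃ K : Set Ω, IsCompact K ∧ ν Kᶜ = 0)
    (hν' : ∃ K : Set Ω, IsCompact K ∧ ν' Kᶜ = 0) :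
    BddAbove {r | ∃ g : Ω → ℝ, LipschitzWith 1 g ∧ r = (∫ x, g x ∂ν) - ∫ x, g x ∂ν'} := by
  obtain ⟨K, hK, hK0⟩ := hν
  obtain ⟨K', hK', hK'0⟩ := hν'
  obtain ⟨x₀⟩ : Nonempty Ω := nonempty_of_isProbabilityMeasure ν
  obtain ⟨R, hR⟩ := (hK.union hK').isBounded.subset_closedBall x₀
  refine ⟨2 * R, ?_⟩
  rintro r ⟨g, hg, rfl⟩
  have key : ∀ (μ : Measure Ω) [IsProbabilityMeasure μ], (∀ᵐ x ∂μ, x ∈ K ∪ K') →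
      |(∫ x, g x ∂μ) - g x₀| ≤ R := by
    intro μ _ hμ
    have hb : ∀ᵐ x ∂μ, ‖g x - g x₀‖ ≤ R := by
      filter_upwards [hμ] with x hx
      rw [← dist_eq_norm]
      simpa using (hg.dist_le_mul x x₀).trans
        (mul_le_mul_of_nonneg_left (Metric.mem_closedBall.1 (hR hx)) zero_le_one)
    have hi : Integrable (fun x => g x - g x₀) μ :=
      .of_bound (hg.continuous.sub continuous_const).aestronglyMeasurable R hb
    have hgi : Integrable g μ := 
      (hi.add (integrable_const (g x₀))).congr (.of_forall fun x => by simp)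
    have h := norm_integral_le_of_norm_le_const hb
    rw [integral_sub hgi (integrable_const _)] at h
    simpa using h
  have h₁ := key ν ((measure_eq_zero_iff_ae_notMem.1 hK0).mono fun x hx =>
    .inl (not_not.1 hx))
  have h₂ := key ν' ((measure_eq_zero_iff_ae_notMem.1 hK'0).mono fun x hx =>
    .inr (not_not.1 hx))
  linarith [(abs_le.1 h₁).2, (abs_le.1 h₂).1]

lemma W1_nonneg [OpensMeasurableSpace Ω] [SecondCountableTopology Ω] {ν ν' : Measure Ω}
    [IsProbabilityMeasure ν] [IsProbabilityMeasure ν'] (hν : ∃ K : Set Ω, IsCompact K ∧ ν Kᶜ = 0)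
    (hν' : ∃ K : Set Ω, IsCompact K ∧ ν' Kᶜ = 0) : 0 ≤ W1 ν ν' :=
  le_csSup (bddAbove_W1 hν hν') ⟨fun _ => 0, LipschitzWith.const' 0, by simp⟩

lemma abs_integral_sub_le_mul_W1 [OpensMeasurableSpace Ω] [SecondCountableTopology Ω]
    {ν ν' : Measure Ω} [IsProbabilityMeasure ν] [IsProbabilityMeasure ν']
    (hν : ∃ K : Set Ω, IsCompact K ∧ ν Kᶜ = 0) (hν' : ∃ K : Set Ω, IsCompact K ∧ ν' Kᶜ = 0)
    {g : Ω → ℝ} {L : NNReal} (hg : LipschitzWith L g) :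
    |(∫ x, g x ∂ν) - ∫ x, g x ∂ν'| ≤ (L + 1) * W1 ν ν' := by
  have hpos : (0 : ℝ) < L + 1 := by positivity
  have key : ∀ s : ℝ, |s| = 1 →
      s * ((∫ x, g x ∂ν) - ∫ x, g x ∂ν') ≤ (L + 1) * W1 ν ν' := by
    intro s hs
    rw [← div_le_iff₀' hpos]
    refine le_csSup (bddAbove_W1 hν hν') ⟨fun x => s / (L + 1) * g x, ?_, ?_⟩
    · refine LipschitzWith.of_dist_le_mul fun x y => ?_
      rw [Real.dist_eq, ← mul_sub, abs_mul, abs_div, hs, abs_of_pos hpos, one_div,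
        ← Real.dist_eq, NNReal.coe_one, one_mul, inv_mul_le_iff₀ hpos]
      refine (hg.dist_le_mul x y).trans ?_
      gcongr
      linarith
    · rw [integral_const_mul, integral_const_mul]
      ring
  refine abs_le.2 ⟨?_, ?_⟩
  · linarith [key (-1) (by simp)]
  · linarith [key 1 (by simp)]

/-- On compactly supported measures, `W1`-balls are finer than weak neighbourhoods. -/
lemma exists_W1_lt_imp_of_eventually [BorelSpace Ω] [SecondCountableTopology Ω]
    {ν₀ : ProbabilityMeasure Ω} (hν₀ : ∃ K : Set Ω, IsCompact K ∧ (ν₀ : Measure Ω) Kᶜ = 0)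
    {p : ProbabilityMeasure Ω → Prop} (hp : ∀ᶠ μ in 𝓝 ν₀, p μ) :
    ∃ δ > (0 : ℝ), ∀ μ : ProbabilityMeasure Ω,
      (∃ K : Set Ω, IsCompact K ∧ (μ : Measure Ω) Kᶜ = 0) → W1 (μ : Measure Ω) ν₀ < δ → p μ := by
  let S := {μ : ProbabilityMeasure Ω // ∃ K : Set Ω, IsCompact K ∧ (μ : Measure Ω) Kᶜ = 0}
  let w : S → ℝ := fun μ => W1 (μ.1 : Measure Ω) ν₀
  have hlim : Tendsto (fun μ : S => μ.1) (comap w (𝓝 0)) (𝓝 ν₀) := by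
    refine tendsto_iff_forall_lipschitz_integral_tendsto.2 fun g _ hg => ?_
    obtain ⟨L, hL⟩ := hg
    rw [tendsto_iff_dist_tendsto_zero]
    refine squeeze_zero (fun _ => dist_nonneg)
      (fun μ => abs_integral_sub_le_mul_W1 μ.2 hν₀ hL) ?_
    have : Tendsto (fun μ : S => ((L : ℝ) + 1) * w μ) (comap w (𝓝 0)) (𝓝 ((L + 1) * 0)) :=
      tendsto_const_nhds.mul tendsto_comap
    rwa [mul_zero] at this
  obtain ⟨δ, hδ, hsub⟩ := ((Metric.nhds_basis_ball (x := (0 : ℝ))).comap w).eventually_iff.1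
    (hlim.eventually hp)
  refine ⟨δ, hδ, fun μ hμ hW => hsub (x := ⟨μ, hμ⟩) ?_⟩
  simp only [Set.mem_preimage, mem_ball_zero_iff, Real.norm_eq_abs]
  exact abs_lt.2 ⟨by linarith [W1_nonneg hμ hν₀], hW⟩

/-- Integrals of a continuous observable of finitely many coordinates depend continuously on the
one-dimensional marginal, uniformly in the parameter. -/
lemma exists_W1_lt_imp_abs_integral_sub_lt [BorelSpace Ω] [SecondCountableTopology Ω]
    {T : Type*} [TopologicalSpace T] [CompactSpace T] [SecondCountableTopology T]
    [TopologicalSpace.PseudoMetrizableSpace T] [MeasurableSpace T] [OpensMeasurableSpace T]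
    {ν₀ : Measure Ω} [IsProbabilityMeasure ν₀]
    (hν₀ : ∃ K : Set Ω, IsCompact K ∧ ν₀ Kᶜ = 0) {P₀ : Measure (ℤ → Ω)}
    (hP₀ : IsBernoulli ν₀ P₀) {g : (ℤ → Ω) × T → ℝ} (hg : Continuous g) {C : ℝ}
    (hC : ∀ p, |g p| ≤ C) {F : Finset ℤ} (hdep : DependsOnCoords g F) {η : ℝ} (hη : 0 < η) :
    ∃ δ > (0 : ℝ), ∀ (ν : Measure Ω), IsProbabilityMeasure ν →
      (∃ K : Set Ω, IsCompact K ∧ ν Kᶜ = 0) → W1 ν ν₀ < δ →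
      ∀ P : Measure (ℤ → Ω), IsBernoulli ν P → ∀ θ : T,
        |(∫ ω, g (ω, θ) ∂P) - ∫ ω, g (ω, θ) ∂P₀| < η := by
  classical
  obtain ⟨x₀⟩ : Nonempty Ω := nonempty_of_isProbabilityMeasure ν₀
  let ext : (F → Ω) → ℤ → Ω := fun u i => if h : i ∈ F then u ⟨i, h⟩ else x₀
  have hext : Continuous ext := by
    refine continuous_pi fun i => ?_
    by_cases h : i ∈ F
    · simpa [ext, h] using continuous_apply (⟨i, h⟩ : F)
    · simpa [ext, h] using continuous_const
  let G : BoundedContinuousFunction ((F → Ω) × T) ℝ :=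
    .ofNormedAddCommGroup (fun x => g (ext x.1, x.2)) (by fun_prop) C fun x => hC _
  have hred : ∀ (ν : Measure Ω) [IsProbabilityMeasure ν] (P : Measure (ℤ → Ω)),
      IsBernoulli ν P → ∀ θ, ∫ ω, g (ω, θ) ∂P = ∫ u, G (u, θ) ∂(Measure.pi fun _ : F => ν) := by
    intro ν _ P hP θ
    have := Measure.infinitePi_map_restrict (I := F) (fun _ : ℤ => ν)
    rw [← hP.eq_infinitePi] at this
    rw [← this, integral_map (Finset.measurable_restrict F).aemeasurable
      (Continuous.aestronglyMeasurable (by fun_prop))]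
    refine integral_congr_ae (.of_forall fun ω => ?_)
    refine hdep _ _ _ fun i hi => ?_
    simp [ext, Finset.mem_coe.1 hi]
  let H : ProbabilityMeasure Ω × T → ℝ := fun x =>
    ∫ u, G (u, x.2) ∂(Measure.pi fun _ : F => (x.1 : Measure Ω))
  have hH : Continuous H := by
    have h1 : Continuous fun x : ProbabilityMeasure Ω × T =>
        (ProbabilityMeasure.pi fun _ : F => x.1).prod (diracProba x.2) := by
      have hpi : Continuous fun x : ProbabilityMeasure Ω × T =>
          ProbabilityMeasure.pi fun _ : F => x.1 :=
        ProbabilityMeasure.continuous_pi.comp (continuous_pi fun _ => continuous_fst)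
      exact ProbabilityMeasure.continuous_prod.comp
        (hpi.prodMk (continuous_diracProba.comp continuous_snd))
    refine (ProbabilityMeasure.continuous_iff_forall_continuous_integral.1 h1 G).congr fun x => ?_
    rw [ProbabilityMeasure.toMeasure_prod, integral_prod _
      (integrable_of_continuous_of_bound G.continuous G.norm_coe_le_norm)]
    refine integral_congr_ae (.of_forall fun u => ?_)
    exact integral_dirac' _ _ (Continuous.stronglyMeasurable (by fun_prop))
  let μ₀ : ProbabilityMeasure Ω := ⟨ν₀, inferInstance⟩
  have hev : ∀ᶠ μ in 𝓝 μ₀, ∀ θ ∈ (Set.univ : Set T), |H (μ, θ) - H (μ₀, θ)| < η := by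
    refine isCompact_univ.eventually_forall_of_forall_eventually fun θ _ => ?_
    have hc : Continuous fun z : ProbabilityMeasure Ω × T => |H z - H (μ₀, z.2)| := by fun_prop
    exact hc.continuousAt.eventually_lt_const (by simpa using hη)
  obtain ⟨δ, hδ, h⟩ := exists_W1_lt_imp_of_eventually (ν₀ := μ₀) hν₀ hev
  refine ⟨δ, hδ, fun ν hν hK hW P hP θ => ?_⟩
  rw [hred ν P hP, hred ν₀ P₀ hP₀]
  exact h ⟨ν, hν⟩ hK hW θ trivial

end Wasserstein

/-- Discarding `M` terms at both ends of every block of length `q = M + p + M`, and the incomplete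
last block, changes a sum of terms bounded by `D` by at most `D * (2 * M * B + q)`. -/
lemma abs_sum_sub_sum_blocks_le {x : ℕ → ℝ} {D : ℝ} (hx : ∀ j, |x j| ≤ D) {M p q : ℕ}
    (hq : q = M + p + M) (B r : ℕ) (hr : r ≤ q) :
    |∑ j ∈ Finset.range (q * B + r), x j -
      ∑ b ∈ Finset.range B, ∑ i ∈ Finset.range p, x (M + i + q * b)| ≤
      D * (2 * M * B + q) := by
  have hbound : ∀ (y : ℕ → ℝ) (k : ℕ), (∀ j, |y j| ≤ D) → |∑ j ∈ Finset.range k, y j| ≤ k * D :=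
    fun y k hy => (Finset.abs_sum_le_sum_abs _ _).trans <|
      (Finset.sum_le_card_nsmul _ _ D fun j _ => hy j).trans (by simp)
  have hD : 0 ≤ D := (abs_nonneg _).trans (hx 0)
  have hfull : |∑ j ∈ Finset.range (q * B), x j -
      ∑ b ∈ Finset.range B, ∑ i ∈ Finset.range p, x (M + i + q * b)| ≤ D * (2 * M * B) := by
    induction B with
    | zero => simp
    | succ B ih =>
      rw [mul_add, mul_one, Finset.sum_range_add, Finset.sum_range_succ]
      have hblock : ∑ j ∈ Finset.range q, x (q * B + j) =
          (∑ j ∈ Finset.range M, x (q * B + j)) +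
          (∑ i ∈ Finset.range p, x (M + i + q * B)) +
          ∑ j ∈ Finset.range M, x (q * B + (M + p + j)) := by
        conv_lhs => rw [hq, Finset.sum_range_add, Finset.sum_range_add]
        congr 2
        · rw [← hq]
        · refine Finset.sum_congr rfl fun i _ => ?_
          rw [← hq, add_comm]
        · simp only [← hq]
      rw [hblock]
      have h₁ := hbound (fun j => x (q * B + j)) M fun j => hx _
      have h₂ := hbound (fun j => x (q * B + (M + p + j))) M fun j => hx _
      push_cast
      rw [abs_le] at *
      constructor <;> linarith [ih.1, ih.2, h₁.1, h₁.2, h₂.1, h₂.2]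
  rw [Finset.sum_range_add]
  have hrest := hbound (fun j => x (q * B + j)) r fun j => hx _
  have hrq : (r : ℝ) * D ≤ q * D := by gcongr
  rw [abs_le] at *
  constructor <;> linarith [hfull.1, hfull.2, hrest.1, hrest.2]

/-- (Base large deviations estimate.) Let `Ω` be a Polish
metric space, `ν₀` compactly supported with ergodic skew-product
`f(ω, θ) = (σω, θ + 𝔞(ω₀))`, and `φ` a bounded continuous observable depending
on finitely many coordinates of `ω`. Then for every `ε > 0` there are
`δ > 0`, `N` and `c > 0` such that for every compactly supported Borel
probability measure `ν` with `W₁(ν, ν₀) < δ`, every `θ` and every `n ≥ N`,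
`ν^ℤ {ω : |(1/n) ∑_{j<n} φ(f^j(ω,θ)) − ∫ φ d(ν^ℤ × m)| ≥ ε} < e^{-cn}`. -/
theorem base_large_deviations
    {Ω : Type*} [MetricSpace Ω] [PolishSpace Ω]
    [MeasurableSpace Ω] [BorelSpace Ω] {d : ℕ}
    (ν₀ : Measure Ω) [IsProbabilityMeasure ν₀]
    (hν₀ : ∃ K : Set Ω, IsCompact K ∧ ν₀ Kᶜ = 0)
    (𝔞 : Ω → Td d) (h𝔞 : Continuous 𝔞)
    (f : ((ℤ → Ω) × Td d) → ((ℤ → Ω) × Td d))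
    (hf : f = fun p => (shiftZ Ω p.1, p.2 + 𝔞 (p.1 0)))
    (ν₀Z : Measure (ℤ → Ω)) (hν₀Z : IsBernoulli ν₀ ν₀Z)
    (herg : Ergodic f (ν₀Z.prod volume))
    (φ : ((ℤ → Ω) × Td d) → ℝ) (hφc : Continuous φ)
    (hφb : ∃ C : ℝ, ∀ p, |φ p| ≤ C)
    (hφfin : ∃ F : Finset ℤ, ∀ (ω ω' : ℤ → Ω) (θ : Td d),
      (∀ i ∈ F, ω i = ω' i) → φ (ω, θ) = φ (ω', θ)) :
    ∀ ε > (0:ℝ), ∃ δ > (0:ℝ), ∃ N : ℕ, ∃ c > (0:ℝ),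
      ∀ (ν : Measure Ω), IsProbabilityMeasure ν →
        (∃ K : Set Ω, IsCompact K ∧ ν Kᶜ = 0) →
        W1 ν ν₀ < δ →
        ∀ (νZ : Measure (ℤ → Ω)), IsBernoulli ν νZ →
          ∀ θ : Td d, ∀ n : ℕ, N ≤ n →
            νZ {ω : ℤ → Ω |
                ε ≤ |(1 / (n : ℝ)) * (∑ j ∈ Finset.range n, φ (f^[j] (ω, θ))) -
                      ∫ p, φ p ∂(νZ.prod volume)|} <
              ENNReal.ofReal (Real.exp (-c * n)) := by
  replace hf : f = skewProduct 𝔞 := hf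
  subst hf
  intro ε hε
  obtain ⟨C₀, hC₀⟩ := hφb
  obtain ⟨F, hF⟩ := hφfin
  obtain ⟨C, hCpos, hC⟩ : ∃ C > (0 : ℝ), ∀ p, |φ p| ≤ C :=
    ⟨max C₀ 1, by positivity, fun p => (hC₀ p).trans (le_max_left _ _)⟩
  obtain ⟨M, hM⟩ : ∃ M : ℕ, ∀ i ∈ F, i ∈ Set.Icc (-(M : ℤ)) M := by
    refine ⟨F.sup Int.natAbs, fun i hi => ?_⟩
    have := Finset.le_sup (f := Int.natAbs) hi
    simp only [Set.mem_Icc]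
    omega
  have hfc : Continuous (skewProduct 𝔞) := continuous_skewProduct h𝔞
  have hφF : DependsOnCoords φ F := hF
  have := hν₀Z.1
  have hmean : ∀ (ν : Measure (ℤ → Ω)) [IsProbabilityMeasure ν],
      ∫ p, φ p ∂(ν.prod (volume : Measure (Td d))) = ∫ θ, ∫ ω, φ (ω, θ) ∂ν := fun ν _ =>
    integral_prod_symm _ (integrable_of_continuous_of_bound hφc hC)
  have hφcoord : ∀ i p : ℕ, i < p → DependsOnCoords
      (fun x => φ ((skewProduct 𝔞)^[M + i] x)) (Set.Ico 0 ((M + p + M : ℕ) : ℤ)) := by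
    intro i p hip
    refine hφF.comp_iterate 𝔞 (M + i) (fun j hj => ?_) (Set.Ico_subset_Ico_right ?_)
    · have := hM j hj
      simp only [Set.mem_Icc] at this
      simp only [Set.mem_Ico]
      omega
    · omega
  set η := ε / 12 with hη
  have hηpos : 0 < η := by positivity
  -- expected block sums for `ν₀`
  set I₀ := ∫ p, φ p ∂(ν₀Z.prod (volume : Measure (Td d))) with hI₀
  obtain ⟨p₀, hp₀⟩ := hν₀Z.exists_abs_sum_integral_sub_le h𝔞 herg
    (φ := fun x => φ ((skewProduct 𝔞)^[M] x)) (hφc.comp (hfc.iterate M)) (fun _ => hC _)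
    (hφF.comp_iterate 𝔞 M (fun j hj => by
      have := hM j hj
      simp only [Set.mem_Icc] at this
      simp only [Set.mem_Ici]
      omega) (fun i hi => hi.1)) hηpos
  have hinv : ∫ x, φ ((skewProduct 𝔞)^[M] x) ∂(ν₀Z.prod (volume : Measure (Td d))) = I₀ := by
    have hmp := (herg.toMeasurePreserving.iterate M).map_eq
    rw [hI₀, ← hmp, integral_map (hfc.iterate M).measurable.aemeasurable
      hφc.aestronglyMeasurable, hmp]
  rw [hinv] at hp₀
  obtain ⟨p₁, hp₁⟩ := exists_nat_ge (16 * C * M / ε)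
  obtain ⟨p, hpp₀, hpp₁, hp1⟩ : ∃ p : ℕ, p₀ ≤ p ∧ p₁ ≤ p ∧ 1 ≤ p :=
    ⟨max p₀ (max p₁ 1), by simp⟩
  have hp : (0 : ℝ) < p := by exact_mod_cast hp1
  have hMp : 16 * C * M ≤ p * ε :=
    (div_le_iff₀ hε).1 (hp₁.trans (by exact_mod_cast hpp₁))
  set q := M + p + M with hq
  have hqpos : 0 < q := by omega
  have hqR : (0 : ℝ) < q := by exact_mod_cast hqpos
  -- continuity in the measure
  set g : (ℤ → Ω) × Td d → ℝ := fun x =>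
    ∑ i ∈ Finset.range p, φ ((skewProduct 𝔞)^[M + i] x) with hg
  have hgc : Continuous g := continuous_finsetSum _ fun i _ => hφc.comp (hfc.iterate _)
  have hgb : ∀ x, |g x| ≤ p * C := fun x =>
    (Finset.abs_sum_le_sum_abs _ _).trans <|
      (Finset.sum_le_card_nsmul _ _ C fun j _ => hC _).trans (by simp)
  have hgdep : DependsOnCoords g (Set.Ico 0 (q : ℤ)) := fun ω ω' θ h =>
    Finset.sum_congr rfl fun i hi => hφcoord i p (Finset.mem_range.1 hi) ω ω' θ h
  obtain ⟨δ₁, hδ₁, hclose₁⟩ := exists_W1_lt_imp_abs_integral_sub_lt hν₀ hν₀Z hφc hC hφF hηpos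
  obtain ⟨δ₂, hδ₂, hclose₂⟩ := exists_W1_lt_imp_abs_integral_sub_lt hν₀ hν₀Z hgc hgb
    (F := Finset.Ico 0 (q : ℤ)) (by simpa using hgdep) (mul_pos hηpos hp)
  -- constants of the exponential estimate
  set D := p * (2 * C) with hD
  have hDpos : 0 < D := by positivity
  set m := 3 * η * p with hm
  have hmpos : 0 < m := by positivity
  obtain ⟨t, ht, htD, htm⟩ : ∃ t > (0 : ℝ), t * D ≤ 1 ∧ t * D ^ 2 ≤ m / 2 := by
    refine ⟨min (1 / D) (m / 2 / D ^ 2), by positivity, ?_, ?_⟩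
    · exact (le_div_iff₀ hDpos).1 (min_le_left _ _)
    · exact (le_div_iff₀ (by positivity)).1 (min_le_right _ _)
  set c := t * m / (8 * q) with hc
  have hcpos : 0 < c := by positivity
  obtain ⟨N₁, hN₁⟩ := exists_nat_ge (8 * C * q / ε)
  obtain ⟨N₂, hN₂⟩ := exists_nat_ge (1 / c)
  refine ⟨min δ₁ δ₂, lt_min hδ₁ hδ₂, max q (max N₁ N₂), c, hcpos, ?_⟩
  intro ν hν hK hW νZ hνZ θ n hn
  have := hνZ.1
  have hqn : q ≤ n := (le_max_left _ _).trans hn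
  have hN₁n : N₁ ≤ n := (le_max_left _ _).trans ((le_max_right _ _).trans hn)
  have hN₂n : N₂ ≤ n := (le_max_right _ _).trans ((le_max_right _ _).trans hn)
  have hnpos : (0 : ℝ) < n := by exact_mod_cast hqpos.trans_le hqn
  have hnC : 8 * C * q ≤ n * ε := (div_le_iff₀ hε).1 (hN₁.trans (by exact_mod_cast hN₁n))
  have hnc : 1 ≤ n * c := (div_le_iff₀ hcpos).1 (hN₂.trans (by exact_mod_cast hN₂n))
  set I := ∫ p, φ p ∂(νZ.prod (volume : Measure (Td d))) with hI
  have hφint : ∀ (ρ : Measure (ℤ → Ω)) [IsProbabilityMeasure ρ] (j : ℕ) (θ : Td d),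
      Integrable (fun ω => φ ((skewProduct 𝔞)^[j] (ω, θ))) ρ := fun ρ _ j θ =>
    integrable_of_continuous_of_bound (hφc.comp ((hfc.iterate j).comp (by fun_prop)))
      fun ω => hC _
  have hII₀ : |I - I₀| ≤ η := by
    have hcont : ∀ (ρ : Measure (ℤ → Ω)) [IsProbabilityMeasure ρ],
        Integrable (fun θ : Td d => ∫ ω, φ (ω, θ) ∂ρ) := fun ρ _ =>
      (integrable_of_continuous_of_bound (μ := ρ.prod (volume : Measure (Td d)))
        hφc hC).integral_prod_right
    rw [hI, hI₀, hmean, hmean, ← integral_sub (hcont νZ) (hcont ν₀Z)]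
    have h := norm_integral_le_of_norm_le_const (μ := (volume : Measure (Td d))) (C := η)
      (f := fun θ => (∫ ω, φ (ω, θ) ∂νZ) - ∫ ω, φ (ω, θ) ∂ν₀Z)
      (.of_forall fun θ => (hclose₁ ν hν hK (hW.trans_le (min_le_left _ _)) νZ hνZ θ).le)
    simpa only [probReal_univ, mul_one, Real.norm_eq_abs] using h
  have hIC : |I| ≤ C := by
    have h := norm_integral_le_of_norm_le_const (μ := νZ.prod (volume : Measure (Td d)))
      (f := φ) (C := C) (.of_forall hC)
    simpa only [probReal_univ, mul_one, Real.norm_eq_abs] using h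
  -- the centred block observable
  set V : (ℤ → Ω) × Td d → ℝ := fun x => g x - p * I with hV
  have hVc : Continuous V := by fun_prop
  have hVb : ∀ x, |V x| ≤ D := fun x => by
    refine (abs_sub _ _).trans ?_
    rw [abs_mul, abs_of_pos hp]
    have := mul_le_mul_of_nonneg_left hIC hp.le
    linarith [hgb x]
  have hVdep : DependsOnCoords V (Set.Ico 0 (q : ℤ)) := fun ω ω' θ h => by
    simp only [hV, hgdep ω ω' θ h]
  have hVm : ∀ θ, |∫ ω, V (ω, θ) ∂νZ| ≤ m := by
    intro θ
    have hgi : ∀ (ρ : Measure (ℤ → Ω)) [IsProbabilityMeasure ρ],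
        Integrable (fun ω => g (ω, θ)) ρ := fun ρ _ =>
      integrable_of_continuous_of_bound (by fun_prop) fun ω => hgb _
    have h₁ := hp₀ p hpp₀ θ
    have h₂ := hclose₂ ν hν hK (hW.trans_le (min_le_right _ _)) νZ hνZ θ
    have h₃ : ∑ i ∈ Finset.range p, ((∫ ω, φ ((skewProduct 𝔞)^[M] ((skewProduct 𝔞)^[i] (ω, θ)))
        ∂ν₀Z) - I₀) = (∫ ω, g (ω, θ) ∂ν₀Z) - p * I₀ := by
      simp only [← Function.iterate_add_apply]
      rw [Finset.sum_sub_distrib, ← integral_finsetSum _ fun i _ => hφint ν₀Z _ θ]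
      simp [hg]
    rw [h₃] at h₁
    have h₄ : ∫ ω, V (ω, θ) ∂νZ = (∫ ω, g (ω, θ) ∂νZ) - p * I := by
      simp only [hV]
      rw [integral_sub (hgi νZ) (integrable_const _)]
      simp
    have h₅ : |p * I - p * I₀| ≤ p * η := by
      rw [← mul_sub, abs_mul, abs_of_pos hp]
      exact mul_le_mul_of_nonneg_left hII₀ hp.le
    rw [h₄]
    rw [abs_le] at h₁ h₅ ⊢
    rw [abs_lt] at h₂
    constructor <;> linarith [h₁.1, h₁.2, h₂.1, h₂.2, h₅.1, h₅.2]
  set B := n / q with hB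
  have hBq : q * B + n % q = n := Nat.div_add_mod n q
  have hB1 : 1 ≤ B := Nat.div_pos hqn hqpos
  set S : (ℤ → Ω) → ℝ := fun ω =>
    ∑ b ∈ Finset.range B, V ((skewProduct 𝔞)^[q * b] (ω, θ)) with hS
  have hup := hνZ.measure_block_sum_ge_le h𝔞 hVc hVb hVdep
    (fun θ => (le_abs_self _).trans (hVm θ)) ht.le htD htm B θ
  have hlow := hνZ.measure_block_sum_ge_le h𝔞 (V := fun x => -V x) hVc.neg
    (fun x => (abs_neg _).trans_le (hVb x))
    (fun ω ω' θ h => congrArg Neg.neg (hVdep ω ω' θ h))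
    (fun θ => by
      rw [integral_neg]
      exact (neg_le_abs _).trans (hVm θ)) ht.le htD htm B θ
  have hsub : {ω : ℤ → Ω | ε ≤ |(1 / (n : ℝ)) *
      (∑ j ∈ Finset.range n, φ ((skewProduct 𝔞)^[j] (ω, θ))) - I|} ⊆
      {ω | B * (2 * m) ≤ S ω} ∪
      {ω | B * (2 * m) ≤ ∑ b ∈ Finset.range B, -V ((skewProduct 𝔞)^[q * b] (ω, θ))} := by
    intro ω hω
    simp only [Set.mem_ofPred_eq] at hω
    have hdiff := abs_sum_sub_sum_blocks_le
      (x := fun j => φ ((skewProduct 𝔞)^[j] (ω, θ)) - I) (D := 2 * C)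
      (fun j => (abs_sub _ _).trans (by linarith [hC ((skewProduct 𝔞)^[j] (ω, θ))])) hq B
      (n % q) (Nat.mod_lt _ hqpos).le
    rw [hBq] at hdiff
    have hblocks : ∑ b ∈ Finset.range B, ∑ i ∈ Finset.range p,
        (φ ((skewProduct 𝔞)^[M + i + q * b] (ω, θ)) - I) = S ω := by
      refine Finset.sum_congr rfl fun b _ => ?_
      simp [hV, hg, Finset.sum_sub_distrib, Function.iterate_add_apply]
    rw [hblocks] at hdiff
    have htot : ε * n ≤ |∑ j ∈ Finset.range n, (φ ((skewProduct 𝔞)^[j] (ω, θ)) - I)| := by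
      have h : ∑ j ∈ Finset.range n, (φ ((skewProduct 𝔞)^[j] (ω, θ)) - I) =
          ((1 / (n : ℝ)) * (∑ j ∈ Finset.range n, φ ((skewProduct 𝔞)^[j] (ω, θ))) - I) * n := by
        rw [Finset.sum_sub_distrib]
        field_simp
        simp
      rw [h, abs_mul, abs_of_pos hnpos]
      exact mul_le_mul_of_nonneg_right hω hnpos.le
    have hBn : (B : ℝ) * (p + 2 * M) ≤ n := by
      have : B * (p + 2 * M) ≤ n := by
        calc B * (p + 2 * M) = q * B := by rw [hq]; ring
          _ ≤ n := hBq ▸ Nat.le_add_right _ _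
      exact_mod_cast this
    have h₁ : (B : ℝ) * (16 * C * M) ≤ B * (p * ε) :=
      mul_le_mul_of_nonneg_left hMp (Nat.cast_nonneg B)
    have h₂ : (B : ℝ) * p * ε ≤ n * ε := by
      refine mul_le_mul_of_nonneg_right (le_trans ?_ hBn) hε.le
      exact mul_le_mul_of_nonneg_left (by simp) (Nat.cast_nonneg B)
    have h₃ : (B : ℝ) * (2 * m) = B * p * ε / 2 := by
      rw [hm, hη]
      ring
    have hbig : (B : ℝ) * (2 * m) ≤ |S ω| := by
      have := abs_sub_abs_le_abs_sub
        (∑ j ∈ Finset.range n, (φ ((skewProduct 𝔞)^[j] (ω, θ)) - I)) (S ω)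
      linarith
    rcases le_abs.1 hbig with h | h
    · exact .inl h
    · refine .inr ?_
      simpa only [Set.mem_ofPred_eq, Finset.sum_neg_distrib] using h
  have hreal : νZ.real {ω : ℤ → Ω | ε ≤ |(1 / (n : ℝ)) *
      (∑ j ∈ Finset.range n, φ ((skewProduct 𝔞)^[j] (ω, θ))) - I|} < Real.exp (-c * n) := by
    refine ((measureReal_mono hsub).trans (measureReal_union_le _ _)).trans_lt ?_
    refine (add_le_add hup hlow).trans_lt ?_
    have hnB : (n : ℝ) ≤ 2 * q * B := by
      have h₁ : n % q < q := Nat.mod_lt _ hqpos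
      have h₂ : q * 1 ≤ q * B := Nat.mul_le_mul_left q hB1
      have : n ≤ 2 * q * B := by
        rw [mul_assoc, two_mul]
        omega
      exact_mod_cast this
    have hexp : Real.exp (-(B * (t * m / 2))) ≤ Real.exp (-(2 * (c * n))) := by
      refine Real.exp_le_exp.2 (neg_le_neg ?_)
      calc 2 * (c * n) ≤ 2 * (c * (2 * q * B)) := by gcongr
        _ = B * (t * m / 2) := by
          rw [hc]
          field_simp
          ring
    have h2 : 2 < Real.exp (c * n) := by
      have h₁ := Real.exp_le_exp.2 (show 1 ≤ c * n by linarith)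
      have h₃ := Real.exp_one_gt_d9
      linarith
    calc Real.exp (-(B * (t * m / 2))) + Real.exp (-(B * (t * m / 2)))
        ≤ 2 * Real.exp (-(2 * (c * n))) := by linarith
      _ < Real.exp (c * n) * Real.exp (-(2 * (c * n))) := by gcongr
      _ = Real.exp (-c * n) := by
        rw [← Real.exp_add]
        congr 1
        ring
  rw [← ofReal_measureReal]
  exact (ENNReal.ofReal_lt_ofReal_iff (Real.exp_pos _)).2 hreal
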